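/- Let (A, Ã) be a dual pair of closed densely defined operators on a complex Hilbert space H with the common core property (common core D), with A dissipative, and let V := ((A − Ã)/(2i))↾_D be its imaginary part. Assume V is strictly positive: there is ε > 0 with ⟨f, Vf⟩ ≥ ε‖f‖² for all f ∈ D(V). Let W_F = V_F^{1/2} and W_K = V_K^{1/2} be the square roots of the Friedrichs and Kreĭn–von Neumann extensions of V; then W_F : D(W_F) → H is bijective, and every v ∈ D(W_K) decomposes uniquely as v = u + Pv with u ∈ D(W_F) and Pv ∈ ker(V*), defining the (unbounded) projection P onto ker(V*) along D(W_F). Let 𝒱 ⊆ D(Ã*) with 𝒱 ∩ D(A) = {0} and L : 𝒱 → H linear. Then the extension A_{𝒱,L} (domain D(A) ∔ 𝒱, acting as f + v ↦ Ã*(f+v) + Lv) is dissipative if and only if 𝒱 ⊆ D(W_K) and for every v ∈ 𝒱: Im⟨v, Ã*v⟩ + Im⟨Pv, Lv⟩ ≥ (1/4)‖ψ_v‖² + ‖W_K v‖², where ψ_v ∈ D(W_F) is the unique element with W_F ψ_v = Lv. -/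

import Mathlib

noncomputable section

open Complex

variable {H : Type*} [NormedAddCommGroup H] [InnerProductSpace ℂ H] [CompleteSpace H]

local notation "⟪" x ", " y "⟫" => @inner ℂ _ _ x y

/-- A partially defined operator is *dissipative* if `Im ⟪ψ, A ψ⟫ ≥ 0` for all `ψ` in its
domain. -/
def Dissipative (A : H →ₗ.[ℂ] H) : Prop :=
  ∀ ψ : A.domain, 0 ≤ (⟪(ψ : H), A ψ⟫).im

/-- A partially defined operator is *symmetric* if `⟪f, S g⟫ = ⟪S f, g⟫` on its domain. -/
def IsSymmetricP (S : H →ₗ.[ℂ] H) : Prop :=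
  ∀ f g : S.domain, ⟪(f : H), S g⟫ = ⟪S f, (g : H)⟫

/-- A partially defined operator is *non-negative* if `⟪f, V f⟫` is real and `≥ 0` on its
domain. -/
def NonnegP (V : H →ₗ.[ℂ] H) : Prop :=
  ∀ f : V.domain, (⟪(f : H), V f⟫).im = 0 ∧ 0 ≤ (⟪(f : H), V f⟫).re

/-- `T = W ∘ W` as partially defined operators: the domain of `T` is
`{x ∈ D(W) : W x ∈ D(W)}` and there `T x = W (W x)`. -/
def IsSqrtOf (W T : H →ₗ.[ℂ] H) : Prop :=
  (∀ x : H, x ∈ T.domain ↔ ∃ hx : x ∈ W.domain, W ⟨x, hx⟩ ∈ W.domain) ∧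
  ∀ (x : H) (hxT : x ∈ T.domain) (hxW : x ∈ W.domain) (hWx : W ⟨x, hxW⟩ ∈ W.domain),
    T ⟨x, hxT⟩ = W ⟨W ⟨x, hxW⟩, hWx⟩

/-- The Ando–Nishio supremum `sup { |⟪h, V f⟫|² / ⟪f, V f⟫ : f ∈ D(V), V f ≠ 0 }`,
computed in `[0, ∞]`. -/
def anSup (V : H →ₗ.[ℂ] H) (h : H) : ENNReal :=
  ⨆ f : {f : V.domain // V f ≠ 0},
    ENNReal.ofReal (‖⟪h, V f.1⟫‖ ^ 2) / ENNReal.ofReal ((⟪(f.1 : H), V f.1⟫).re)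

/-- `W` is the square root of the Friedrichs extension of `V`: `W` is a non-negative
selfadjoint operator, `W ∘ W` is a non-negative selfadjoint extension of `V`, and `D(V)` is a
core for `W`. -/
def IsFriedrichsSqrt (V W : H →ₗ.[ℂ] H) : Prop :=
  IsSelfAdjoint W ∧ NonnegP W ∧
    (∃ T : H →ₗ.[ℂ] H, IsSqrtOf W T ∧ IsSelfAdjoint T ∧ NonnegP T ∧ V ≤ T) ∧
    (W.domRestrict V.domain).closure = W

/-- `W` is the square root of the Kreĭn–von Neumann extension of `V` (Ando–Nishio
characterization): `W` is a non-negative selfadjoint operator, `W ∘ W` is a non-negative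
selfadjoint extension of `V`, the domain of `W` consists exactly of those `h` with
`anSup V h < ∞`, and `‖W h‖² = anSup V h` there. -/
def IsKreinSqrt (V W : H →ₗ.[ℂ] H) : Prop :=
  IsSelfAdjoint W ∧ NonnegP W ∧
    (∃ T : H →ₗ.[ℂ] H, IsSqrtOf W T ∧ IsSelfAdjoint T ∧ NonnegP T ∧ V ≤ T) ∧
    (∀ h : H, h ∈ W.domain ↔ anSup V h < ⊤) ∧
    ∀ (h : H) (hh : h ∈ W.domain), ENNReal.ofReal (‖W ⟨h, hh⟩‖ ^ 2) = anSup V h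


open Filter Topology in
lemma core_seq (B : H →ₗ.[ℂ] H) (S : Submodule ℂ H) (hc : (B.domRestrict S).closure = B)
    (x : B.domain) : ∃ s : ℕ → B.domain, (∀ n, (s n : H) ∈ S) ∧
      Tendsto (fun n => (s n : H)) atTop (𝓝 (x : H)) ∧
      Tendsto (fun n => B (s n)) atTop (𝓝 (B x)) := by
  have h1 : ((x : H), B x) ∈ (B.domRestrict S).graph.topologicalClosure := by
    by_cases h : (B.domRestrict S).IsClosable
    · rw [h.graph_closure_eq_closure_graph, hc]
      exact B.mem_graph x
    · rw [LinearPMap.closure_def' h] at hc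
      apply Submodule.le_topologicalClosure
      rw [hc]
      exact B.mem_graph x
  have h2 : ((x : H), B x) ∈ closure ((B.domRestrict S).graph : Set (H × H)) := h1
  obtain ⟨t, ht, hlim⟩ := mem_closure_iff_seq_limit.1 h2
  have h3 : ∀ n, ∃ y : B.domain, (y : H) ∈ S ∧ (y : H) = (t n).1 ∧ B y = (t n).2 := by
    intro n
    obtain ⟨y, hy1, hy2⟩ := (LinearPMap.mem_graph_iff _).1 (ht n)
    refine ⟨⟨y, y.2.2⟩, y.2.1, hy1, ?_⟩
    rw [← hy2]
    exact (LinearPMap.domRestrict_apply rfl).symm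
  choose s hs1 hs2 hs3 using h3
  refine ⟨s, hs1, ?_, ?_⟩
  · simp_rw [hs2]; exact (continuous_fst.tendsto _).comp hlim
  · simp_rw [hs3]; exact (continuous_snd.tendsto _).comp hlim

lemma sa_inner {W : H →ₗ.[ℂ] H} (hW : IsSelfAdjoint W) (x y : W.domain) :
    ⟪W x, (y : H)⟫ = ⟪(x : H), W y⟫ := by
  have h := LinearPMap.adjoint_isFormalAdjoint hW.dense_domain
  rw [LinearPMap.isSelfAdjoint_def.1 hW] at h
  exact h x y

lemma sa_mem {W : H →ₗ.[ℂ] H} (hW : IsSelfAdjoint W) (h w : H)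
    (hh : ∀ x : W.domain, ⟪w, (x : H)⟫ = ⟪h, W x⟫) : ∃ hd : h ∈ W.domain, W ⟨h, hd⟩ = w := by
  have hd : h ∈ W.domain := by
    rw [← LinearPMap.isSelfAdjoint_def.1 hW]
    exact LinearPMap.mem_adjoint_domain_of_exists _ ⟨w, hh⟩
  refine ⟨hd, ?_⟩
  refine hW.dense_domain.eq_of_inner_left ℂ fun z hz => ?_
  rw [hh ⟨z, hz⟩]
  exact sa_inner hW ⟨h, hd⟩ ⟨z, hz⟩

open Filter Topology in
lemma sa_bij {W : H →ₗ.[ℂ] H} (hW : IsSelfAdjoint W) (ε : ℝ) (hε : 0 < ε)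
    (hb : ∀ g : W.domain, ε * ‖(g : H)‖ ^ 2 ≤ ‖W g‖ ^ 2) :
    Function.Bijective (fun g : W.domain => W g) := by
  have hker : ∀ g : W.domain, W g = 0 → (g : H) = 0 := by
    intro g hg
    have := hb g
    rw [hg] at this
    have h0 : ‖(g : H)‖ ^ 2 ≤ 0 := by
      by_contra hc
      push Not at hc
      have := mul_pos hε hc
      simp at *
      linarith
    have : ‖(g : H)‖ = 0 := by nlinarith [norm_nonneg (g : H)]
    simpa using this
  constructor
  · intro a b hab
    have : W (a - b) = 0 := by
      rw [LinearPMap.map_sub]; exact sub_eq_zero.2 hab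
    have := hker _ this
    ext
    simpa [sub_eq_zero] using this
  · intro y
    have hd : (LinearMap.range W.toFun).topologicalClosure = ⊤ := by
      rw [Submodule.topologicalClosure_eq_top_iff, Submodule.eq_bot_iff]
      intro z hz
      rw [Submodule.mem_orthogonal'] at hz
      obtain ⟨hd, h0⟩ := sa_mem hW z 0 (fun x => by
        rw [inner_zero_left]; exact (hz _ ⟨x, rfl⟩).symm)
      exact hker _ h0
    have hy : y ∈ closure ((LinearMap.range W.toFun : Submodule ℂ H) : Set H) := by
      have : y ∈ (LinearMap.range W.toFun).topologicalClosure := by rw [hd]; trivial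
      exact this
    obtain ⟨t, ht, hlim⟩ := mem_closure_iff_seq_limit.1 hy
    choose s hs using ht
    have hs' : ∀ n, W (s n) = t n := hs
    have hbb : ∀ a b : W.domain, dist (a : H) (b : H) ≤ (√ε)⁻¹ * dist (W a) (W b) := by
      intro a b
      have h1 := hb (a - b)
      rw [LinearPMap.map_sub] at h1
      rw [dist_eq_norm, dist_eq_norm]
      have hse : 0 < √ε := Real.sqrt_pos.2 hε
      rw [inv_mul_eq_div, le_div_iff₀ hse]
      refine (sq_le_sq₀ (by positivity) (by positivity)).1 ?_
      rw [mul_pow, Real.sq_sqrt hε.le, mul_comm]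
      simpa using h1
    have hcs : CauchySeq (fun n => (s n : H)) := by
      have hct := hlim.cauchySeq
      rw [Metric.cauchySeq_iff'] at hct ⊢
      intro δ hδ
      have hse : 0 < √ε := Real.sqrt_pos.2 hε
      obtain ⟨N, hN⟩ := hct (√ε * δ) (by positivity)
      refine ⟨N, fun n hn => ?_⟩
      have h2 := hN n hn
      have h3 := hbb (s n) (s N)
      rw [hs', hs'] at h3
      calc _ ≤ _ := h3
        _ < (√ε)⁻¹ * (√ε * δ) := by gcongr
        _ = δ := by field_simp
    obtain ⟨x, hx⟩ := cauchySeq_tendsto_of_complete hcs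
    obtain ⟨hd, h0⟩ := sa_mem hW x y (fun z => by
      have e1 : Tendsto (fun n => ⟪t n, (z : H)⟫) atTop (𝓝 ⟪y, (z : H)⟫) :=
        hlim.inner tendsto_const_nhds
      have e2 : Tendsto (fun n => ⟪(s n : H), W z⟫) atTop (𝓝 ⟪x, W z⟫) :=
        hx.inner tendsto_const_nhds
      refine tendsto_nhds_unique e1 (e2.congr fun n => ?_)
      rw [← hs', sa_inner hW])
    exact ⟨⟨x, hd⟩, h0⟩

lemma riesz_ext {E : Type*} [AddCommGroup E] [Module ℂ E] (R : E →ₗ[ℂ] H) (hR : DenseRange R)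
    (φ : E →ₗ[ℂ] ℂ) (K : ℝ) (hK : ∀ f, ‖φ f‖ ^ 2 ≤ K * ‖R f‖ ^ 2) :
    ∃ w : H, ∀ f, φ f = ⟪w, R f⟫ := by
  have hb : ∃ C, ∀ x, ‖φ x‖ ≤ C * ‖R x‖ := by
    refine ⟨√(max K 0), fun x => ?_⟩
    refine (sq_le_sq₀ (by positivity) (by positivity)).1 ?_
    rw [mul_pow, Real.sq_sqrt (le_max_right _ _)]
    exact (hK x).trans (by gcongr; exact le_max_left _ _)
  refine ⟨(InnerProductSpace.toDual ℂ H).symm (φ.extendOfNorm R), fun f => ?_⟩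
  rw [InnerProductSpace.toDual_symm_apply, LinearMap.extendOfNorm_eq hR hb]

lemma sq_id (g w ψ : H) : ‖g + w - (Complex.I / 2) • ψ‖ ^ 2 =
    ‖g‖ ^ 2 + 2 * (⟪w, g⟫).re + (⟪g, ψ⟫).im + (‖w‖ ^ 2 + (1 / 4) * ‖ψ‖ ^ 2 + (⟪w, ψ⟫).im) := by
  have h1 := @norm_sub_sq ℂ H _ _ _ (g + w) ((Complex.I / 2) • ψ)
  have h2 := @norm_add_sq ℂ H _ _ _ g w
  rw [h1, h2, norm_smul, inner_smul_right, inner_add_left]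
  have h3 : (⟪g, w⟫).re = (⟪w, g⟫).re := by
    rw [← inner_conj_symm g w, Complex.conj_re]
  simp [h3]
  ring

lemma opt {E : Type*} [AddCommGroup E] [Module ℂ E] (R : E →ₗ[ℂ] H) (hR : DenseRange R)
    (w ψ : H) (c : ℝ) :
    (∀ f, 0 ≤ ‖R f‖ ^ 2 + 2 * (⟪w, R f⟫).re + (⟪R f, ψ⟫).im + c) ↔
      ‖w‖ ^ 2 + (1 / 4) * ‖ψ‖ ^ 2 + (⟪w, ψ⟫).im ≤ c := by
  constructor
  · intro h
    have h2 : ∀ g : H, 0 ≤ ‖g‖ ^ 2 + 2 * (⟪w, g⟫).re + (⟪g, ψ⟫).im + c := by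
      intro g
      refine hR.induction_on (p := fun g => 0 ≤ ‖g‖ ^ 2 + 2 * (⟪w, g⟫).re + (⟪g, ψ⟫).im + c) g
        ?_ h
      refine isClosed_le continuous_const ?_
      have c1 : Continuous fun g : H => (⟪w, g⟫).re :=
        Complex.continuous_re.comp (continuous_const.inner continuous_id)
      have c2 : Continuous fun g : H => (⟪g, ψ⟫).im :=
        Complex.continuous_im.comp (continuous_id.inner continuous_const)
      fun_prop
    have h3 := h2 ((Complex.I / 2) • ψ - w)
    have h4 := sq_id ((Complex.I / 2) • ψ - w) w ψ
    simp only [sub_add_cancel, sub_self, norm_zero] at h4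
    linarith
  · intro h f
    have := sq_id (R f) w ψ
    have := sq_nonneg ‖R f + w - (Complex.I / 2) • ψ‖
    linarith

lemma bdd_of_form {E : Type*} [AddCommGroup E] [Module ℂ E] (R : E →ₗ[ℂ] H)
    (φ : E →ₗ[ℂ] ℂ) (ψ : H) (c : ℝ)
    (h : ∀ f, 0 ≤ ‖R f‖ ^ 2 + 2 * (φ f).re + (⟪R f, ψ⟫).im + c) :
    ∃ K : ℝ, 0 ≤ K ∧ ∀ f, ‖φ f‖ ^ 2 ≤ K * ‖R f‖ ^ 2 := by
  have hc : 0 ≤ c := by simpa using h 0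
  have key : ∀ f, (φ f).re ^ 2 ≤ (2 * c + ‖ψ‖ ^ 2) * ‖R f‖ ^ 2 := by
    intro f
    have hd := discrim_le_zero (a := ‖R f‖ ^ 2) (b := 2 * (φ f).re + (⟪R f, ψ⟫).im) (c := c)
      (fun t => by
        have := h ((t : ℂ) • f)
        rw [map_smul, map_smul, norm_smul, inner_smul_left] at this
        simp [mul_pow] at this
        nlinarith)
    unfold discrim at hd
    have h1 : (⟪R f, ψ⟫).im ^ 2 ≤ ‖R f‖ ^ 2 * ‖ψ‖ ^ 2 := by
      have e1 := Complex.abs_im_le_norm ⟪R f, ψ⟫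
      have e2 := norm_inner_le_norm (𝕜 := ℂ) (R f) ψ
      rw [← mul_pow, ← sq_abs]
      gcongr
      exact e1.trans e2
    nlinarith [sq_nonneg (2 * (φ f).re + 2 * (⟪R f, ψ⟫).im), mul_nonneg (sq_nonneg ‖R f‖) (sq_nonneg ‖ψ‖)]
  refine ⟨2 * (2 * c + ‖ψ‖ ^ 2), by positivity, fun f => ?_⟩
  have k1 := key f
  have k2 := key (Complex.I • f)
  rw [map_smul, map_smul, norm_smul] at k2
  simp at k2
  rw [Complex.sq_norm, Complex.normSq_apply]
  nlinarith

lemma anSup_le {V : H →ₗ.[ℂ] H} {ε : ℝ} (hε : 0 < ε)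
    (hstrict : ∀ f : V.domain, ε * ‖(f : H)‖ ^ 2 ≤ (⟪(f : H), V f⟫).re) (h : H) (K : ℝ)
    (hK : 0 ≤ K) :
    anSup V h ≤ ENNReal.ofReal K ↔ ∀ f : V.domain, ‖⟪h, V f⟫‖ ^ 2 ≤ K * (⟪(f : H), V f⟫).re := by
  have hpos : ∀ f : V.domain, V f ≠ 0 → 0 < (⟪(f : H), V f⟫).re := by
    intro f hf
    have hf0 : (f : H) ≠ 0 := by
      intro h0
      have : f = 0 := by ext; simpa using h0
      rw [this] at hf
      simp at hf
    have := hstrict f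
    have : 0 < ε * ‖(f : H)‖ ^ 2 := by positivity
    linarith
  unfold anSup
  rw [iSup_le_iff]
  have e : ∀ f : V.domain, V f ≠ 0 →
      (ENNReal.ofReal (‖⟪h, V f⟫‖ ^ 2) / ENNReal.ofReal ((⟪(f : H), V f⟫).re) ≤ ENNReal.ofReal K ↔
        ‖⟪h, V f⟫‖ ^ 2 ≤ K * (⟪(f : H), V f⟫).re) := by
    intro f hf
    rw [← ENNReal.ofReal_div_of_pos (hpos f hf), ENNReal.ofReal_le_ofReal_iff hK,
      div_le_iff₀ (hpos f hf)]
  constructor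
  · intro hh f
    by_cases hf : V f = 0
    · simp [hf]
    · exact (e f hf).1 (hh ⟨f, hf⟩)
  · rintro hh ⟨f, hf⟩
    exact (e f hf).2 (hh f)

lemma form_id (f v a b c l : H) (h1 : ⟪b, f⟫ = ⟪f, a⟫) (h2 : ⟪b, v⟫ = ⟪f, c⟫) :
    (⟪f + v, a + c + l⟫).im = (⟪f, (2 * Complex.I)⁻¹ • (a - b)⟫).re
      + 2 * (⟪v, (2 * Complex.I)⁻¹ • (a - b)⟫).re + (⟪f, l⟫).im
      + ((⟪v, c⟫).im + (⟪v, l⟫).im) := by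
  have e1 : ⟪f, b⟫ = starRingEnd ℂ ⟪f, a⟫ := by rw [← h1, inner_conj_symm]
  have e2 : ⟪v, b⟫ = starRingEnd ℂ ⟪f, c⟫ := by rw [← h2, inner_conj_symm]
  simp only [inner_add_left, inner_add_right, inner_smul_right, inner_sub_right, e1, e2]
  generalize ⟪f, a⟫ = x
  generalize ⟪f, c⟫ = y
  simp
  ring

/-- The strictly positive case `V ≥ ε > 0`: `V_F^{1/2}` is a bijection onto
`H`, every `v ∈ D(V_K^{1/2})` decomposes uniquely as `v = u + P v` with `u ∈ D(V_F^{1/2})`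
and `P v ∈ ker V*`, and `A_{𝓥,L}` is dissipative iff `𝓥 ⊆ D(V_K^{1/2})` and
`Im ⟪v, Ã* v⟫ + Im ⟪P v, L v⟫ ≥ ¼ ‖ψ_v‖² + ‖V_K^{1/2} v‖²` for all `v ∈ 𝓥`, where
`V_F^{1/2} ψ_v = L v`. -/
theorem statement11
    (A At V : H →ₗ.[ℂ] H) (D : Submodule ℂ H)
    (hAdense : Dense (A.domain : Set H)) (hAtdense : Dense (At.domain : Set H))
    (hAclosed : A.IsClosed) (hAtclosed : At.IsClosed)
    (hdual : A ≤ At.adjoint)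
    (hDA : D ≤ A.domain) (hDAt : D ≤ At.domain)
    (hcoreA : (A.domRestrict D).closure = A)
    (hcoreAt : (At.domRestrict D).closure = At)
    (hdiss : Dissipative A)
    (hVdom : V.domain = D)
    (hV : ∀ (x : H) (hxV : x ∈ V.domain) (hxA : x ∈ A.domain) (hxAt : x ∈ At.domain),
      V ⟨x, hxV⟩ = (2 * Complex.I)⁻¹ • (A ⟨x, hxA⟩ - At ⟨x, hxAt⟩))
    (𝓥 : Submodule ℂ H) (h𝓥 : 𝓥 ≤ At.adjoint.domain) (h𝓥A : 𝓥 ⊓ A.domain = ⊥)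
    (L : 𝓥 →ₗ[ℂ] H)
    (WF WK : H →ₗ.[ℂ] H)
    (hWF : IsFriedrichsSqrt V WF) (hWK : IsKreinSqrt V WK)
    (ε : ℝ) (hε : 0 < ε)
    (hstrict : ∀ f : V.domain, ε * ‖(f : H)‖ ^ 2 ≤ (⟪(f : H), V f⟫).re) :
    Function.Bijective (fun g : WF.domain => WF g) ∧
    (∀ h : H, h ∈ WK.domain →
      ∃! p : H, (∃ hp : p ∈ V.adjoint.domain, V.adjoint ⟨p, hp⟩ = 0) ∧
        h - p ∈ WF.domain) ∧
    ((∀ (f : A.domain) (v : 𝓥) (hfv : (f : H) + (v : H) ∈ At.adjoint.domain),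
      0 ≤ (⟪(f : H) + (v : H), At.adjoint ⟨(f : H) + (v : H), hfv⟩ + L v⟫).im) ↔
      ((∀ v : 𝓥, (v : H) ∈ WK.domain) ∧
        ∀ (v : 𝓥) (hv : (v : H) ∈ At.adjoint.domain) (hvK : (v : H) ∈ WK.domain)
          (p : H) (hp : p ∈ V.adjoint.domain), V.adjoint ⟨p, hp⟩ = 0 →
          (v : H) - p ∈ WF.domain →
          ∀ (ψ : H) (hψ : ψ ∈ WF.domain), WF ⟨ψ, hψ⟩ = L v →
            (1 / 4) * ‖ψ‖ ^ 2 + ‖WK ⟨(v : H), hvK⟩‖ ^ 2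
              ≤ (⟪(v : H), At.adjoint ⟨(v : H), hv⟩⟫).im + (⟪p, L v⟫).im)) := by
  obtain ⟨hFsa, -, ⟨T, hTsq, -, -, hVT⟩, hFcore⟩ := hWF
  obtain ⟨-, -, -, hKdom, hKnorm⟩ := hWK
  -- basic facts on the Friedrichs square root
  have hVW : ∀ f : V.domain, ∃ hf : (f : H) ∈ WF.domain, ∃ hWf : WF ⟨f, hf⟩ ∈ WF.domain,
      V f = WF ⟨WF ⟨f, hf⟩, hWf⟩ := by
    intro f
    have hfT : (f : H) ∈ T.domain := hVT.1 f.2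
    obtain ⟨hf, hWf⟩ := (hTsq.1 f).1 hfT
    refine ⟨hf, hWf, ?_⟩
    rw [← hTsq.2 f hfT hf hWf]
    exact hVT.2 rfl
  have hVdomW : V.domain ≤ WF.domain := fun x hx => (hVW ⟨x, hx⟩).1
  let R : V.domain →ₗ[ℂ] H := WF.toFun.comp (Submodule.inclusion hVdomW)
  have hRdef : ∀ (f : V.domain) (hf : (f : H) ∈ WF.domain), R f = WF ⟨f, hf⟩ := fun f hf => rfl
  have hRa : ∀ (u : WF.domain) (f : V.domain), ⟪(u : H), V f⟫ = ⟪WF u, R f⟫ := by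
    intro u f
    obtain ⟨hf, hWf, he⟩ := hVW f
    rw [he, hRdef f hf, ← sa_inner hFsa]
  have hRd : ∀ (u : WF.domain) (f : V.domain), ⟪(f : H), WF u⟫ = ⟪R f, (u : H)⟫ := by
    intro u f
    obtain ⟨hf, hWf, he⟩ := hVW f
    rw [hRdef f hf, sa_inner hFsa]
  have hRc : ∀ f : V.domain, (⟪(f : H), V f⟫).re = ‖R f‖ ^ 2 := by
    intro f
    obtain ⟨hf, hWf, he⟩ := hVW f
    rw [hRa ⟨f, hf⟩ f, ← hRdef f hf]
    exact (norm_sq_eq_re_inner (𝕜 := ℂ) _).symm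
  have hlow : ∀ g : WF.domain, ε * ‖(g : H)‖ ^ 2 ≤ ‖WF g‖ ^ 2 := by
    intro g
    obtain ⟨s, hs, h1, h2⟩ := core_seq WF V.domain hFcore g
    refine le_of_tendsto_of_tendsto' ((h1.norm.pow 2).const_mul ε) (h2.norm.pow 2) fun n => ?_
    have := hstrict ⟨s n, hs n⟩
    rw [hRc] at this
    exact this
  have hbij := sa_bij hFsa ε hε hlow
  have hRdense : DenseRange R := by
    intro y
    obtain ⟨g, rfl⟩ := hbij.2 y
    obtain ⟨s, hs, h1, h2⟩ := core_seq WF V.domain hFcore g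
    exact mem_closure_of_tendsto h2 (Filter.Eventually.of_forall fun n => ⟨⟨s n, hs n⟩, rfl⟩)
  have hVdense : Dense (V.domain : Set H) := by
    have : (WF.domain : Set H) ⊆ closure (V.domain : Set H) := by
      intro x hx
      obtain ⟨s, hs, h1, h2⟩ := core_seq WF V.domain hFcore ⟨x, hx⟩
      exact mem_closure_of_tendsto h1 (Filter.Eventually.of_forall fun n => hs n)
    exact dense_closure.1 (hFsa.dense_domain.mono this)
  have hker : ∀ p : H, (∃ hp : p ∈ V.adjoint.domain, V.adjoint ⟨p, hp⟩ = 0) ↔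
      ∀ f : V.domain, ⟪p, V f⟫ = 0 := by
    intro p
    constructor
    · rintro ⟨hp, h0⟩ f
      have := LinearPMap.adjoint_isFormalAdjoint hVdense ⟨p, hp⟩ f
      rw [h0, inner_zero_left] at this
      exact this.symm
    · intro h
      have hp : p ∈ V.adjoint.domain :=
        LinearPMap.mem_adjoint_domain_of_exists _ ⟨0, fun x => by rw [h x, inner_zero_left]⟩
      exact ⟨hp, LinearPMap.adjoint_apply_eq hVdense _ fun x => by
        rw [inner_zero_left]; exact (h x).symm⟩
  have hKiff : ∀ h : H, (∃ K : ℝ, 0 ≤ K ∧ ∀ f : V.domain, ‖⟪h, V f⟫‖ ^ 2 ≤ K * ‖R f‖ ^ 2) ↔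
      h ∈ WK.domain := by
    intro h
    rw [hKdom]
    constructor
    · rintro ⟨K, hK, hh⟩
      exact lt_of_le_of_lt ((anSup_le hε hstrict h K hK).2 fun f => by rw [hRc]; exact hh f)
        ENNReal.ofReal_lt_top
    · intro hh
      refine ⟨(anSup V h).toReal, ENNReal.toReal_nonneg, fun f => ?_⟩
      rw [← hRc]
      exact (anSup_le hε hstrict h _ ENNReal.toReal_nonneg).1
        (by rw [ENNReal.ofReal_toReal hh.ne]) f
  have hKn : ∀ (h : H) (hh : h ∈ WK.domain) (w : H), (∀ f : V.domain, ⟪h, V f⟫ = ⟪w, R f⟫) →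
      ‖WK ⟨h, hh⟩‖ ^ 2 = ‖w‖ ^ 2 := by
    intro h hh w hw
    have hn := hKnorm h hh
    apply le_antisymm
    · rw [← ENNReal.ofReal_le_ofReal_iff (by positivity), hn,
        anSup_le hε hstrict h _ (by positivity)]
      intro f
      rw [hRc, hw, ← mul_pow]
      gcongr
      exact norm_inner_le_norm _ _
    · have h1 := (anSup_le hε hstrict h (‖WK ⟨h, hh⟩‖ ^ 2) (by positivity)).1 hn.ge
      have h2 : ∀ g : H, ‖⟪w, g⟫‖ ^ 2 ≤ ‖WK ⟨h, hh⟩‖ ^ 2 * ‖g‖ ^ 2 := by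
        intro g
        refine hRdense.induction_on
          (p := fun g => ‖⟪w, g⟫‖ ^ 2 ≤ ‖WK ⟨h, hh⟩‖ ^ 2 * ‖g‖ ^ 2) g ?_ ?_
        · refine isClosed_le ?_ (by fun_prop)
          exact ((continuous_const.inner continuous_id).norm).pow 2
        · intro f
          rw [← hw, ← hRc]
          exact h1 f
      by_cases hw0 : w = 0
      · rw [hw0]; simp
      have h3 := h2 w
      have h4 : ‖⟪w, w⟫‖ = ‖w‖ ^ 2 := by
        rw [inner_self_eq_norm_sq_to_K]; simp
      rw [h4, sq (‖w‖ ^ 2)] at h3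
      exact le_of_mul_le_mul_right h3 (by positivity)
  have hdec : ∀ h : H, h ∈ WK.domain → ∃ p : H, (∀ f : V.domain, ⟪p, V f⟫ = 0) ∧
      h - p ∈ WF.domain := by
    intro h hh
    obtain ⟨K, hK, hb⟩ := (hKiff h).2 hh
    obtain ⟨w, hw⟩ := riesz_ext R hRdense ((innerₛₗ ℂ h).comp V.toFun) K hb
    obtain ⟨u, hu⟩ := hbij.2 w
    refine ⟨h - u, fun f => ?_, by simp⟩
    rw [inner_sub_left, hRa]
    have h1 : ⟪h, V f⟫ = ⟪w, R f⟫ := hw f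
    have h2 : WF u = w := hu
    rw [h1, h2, sub_self]
  -- the quadratic form
  have hform : ∀ (f : V.domain) (v : 𝓥) (hv : (v : H) ∈ At.adjoint.domain)
      (hfv : (f : H) + (v : H) ∈ At.adjoint.domain),
      (⟪(f : H) + (v : H), At.adjoint ⟨(f : H) + (v : H), hfv⟩ + L v⟫).im =
        ‖R f‖ ^ 2 + 2 * (⟪(v : H), V f⟫).re + (⟪(f : H), L v⟫).im
        + ((⟪(v : H), At.adjoint ⟨(v : H), hv⟩⟫).im + (⟪(v : H), L v⟫).im) := by
    intro f v hv hfv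
    have hfD : (f : H) ∈ D := hVdom ▸ f.2
    have hfA := hDA hfD
    have hfAt := hDAt hfD
    have hfAd : (f : H) ∈ At.adjoint.domain := hdual.1 hfA
    have hsum : At.adjoint ⟨(f : H) + (v : H), hfv⟩ = A ⟨f, hfA⟩ + At.adjoint ⟨v, hv⟩ := by
      have e1 : A ⟨f, hfA⟩ = At.adjoint ⟨f, hfAd⟩ := hdual.2 rfl
      rw [e1, ← LinearPMap.map_add]
      rfl
    have hadj := LinearPMap.adjoint_isFormalAdjoint hAtdense
    rw [← hRc, hV f f.2 hfA hfAt, hsum]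
    refine form_id _ _ _ _ _ _ ?_ ?_
    · have e1 : A ⟨f, hfA⟩ = At.adjoint ⟨f, hfAd⟩ := hdual.2 rfl
      rw [e1]
      exact hadj.symm ⟨f, hfAt⟩ ⟨f, hfAd⟩
    · exact hadj.symm ⟨f, hfAt⟩ ⟨v, hv⟩
  have hred : (∀ (f : A.domain) (v : 𝓥) (hfv : (f : H) + (v : H) ∈ At.adjoint.domain),
      0 ≤ (⟪(f : H) + (v : H), At.adjoint ⟨(f : H) + (v : H), hfv⟩ + L v⟫).im) ↔
      ∀ (v : 𝓥) (hv : (v : H) ∈ At.adjoint.domain) (f : V.domain),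
        0 ≤ ‖R f‖ ^ 2 + 2 * (⟪(v : H), V f⟫).re + (⟪(f : H), L v⟫).im
        + ((⟪(v : H), At.adjoint ⟨(v : H), hv⟩⟫).im + (⟪(v : H), L v⟫).im) := by
    constructor
    · intro h v hv f
      have hfA : (f : H) ∈ A.domain := hDA (hVdom ▸ f.2)
      have hfv : (f : H) + (v : H) ∈ At.adjoint.domain := Submodule.add_mem _ (hdual.1 hfA) hv
      rw [← hform f v hv hfv]
      exact h ⟨f, hfA⟩ v hfv
    · intro h f v hfv
      have hv := h𝓥 v.2
      obtain ⟨s, hs, h1, h2⟩ := core_seq A D hcoreA f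
      have hadd : ∀ (g : A.domain) (hgv : (g : H) + (v : H) ∈ At.adjoint.domain),
          At.adjoint ⟨(g : H) + (v : H), hgv⟩ = A g + At.adjoint ⟨v, hv⟩ := by
        intro g hgv
        have e1 : A g = At.adjoint ⟨g, hdual.1 g.2⟩ := hdual.2 rfl
        rw [e1, ← LinearPMap.map_add]
        rfl
      rw [hadd]
      have hl := (Complex.continuous_im.tendsto _).comp
        ((h1.add_const (v : H)).inner (𝕜 := ℂ)
          ((h2.add_const (At.adjoint ⟨(v : H), hv⟩)).add_const (L v)))
      refine ge_of_tendsto' hl fun n => ?_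
      have hgv : (s n : H) + (v : H) ∈ At.adjoint.domain :=
        Submodule.add_mem _ (hdual.1 (s n).2) hv
      have hsV : (s n : H) ∈ V.domain := hVdom ▸ hs n
      have h3 := h v hv ⟨s n, hsV⟩
      rw [← hform ⟨s n, hsV⟩ v hv hgv] at h3
      rw [hadd (s n) hgv] at h3
      exact h3
  -- pointwise criterion
  have hcrit : ∀ (l v p ψ : H) (c : ℝ) (hvK : v ∈ WK.domain) (hp : ∀ f : V.domain, ⟪p, V f⟫ = 0)
      (hvp : v - p ∈ WF.domain) (hψ : ψ ∈ WF.domain), WF ⟨ψ, hψ⟩ = l →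
      ((∀ f : V.domain, 0 ≤ ‖R f‖ ^ 2 + 2 * (⟪v, V f⟫).re + (⟪(f : H), l⟫).im
        + (c + (⟪v, l⟫).im)) ↔
      (1 / 4) * ‖ψ‖ ^ 2 + ‖WK ⟨v, hvK⟩‖ ^ 2 ≤ c + (⟪p, l⟫).im) := by
    intro l v p ψ c hvK hp hvp hψ hl
    have hw : ∀ f : V.domain, ⟪v, V f⟫ = ⟪WF ⟨v - p, hvp⟩, R f⟫ := by
      intro f
      rw [← hRa ⟨v - p, hvp⟩ f, inner_sub_left, hp, sub_zero]
    rw [hKn v hvK _ hw]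
    have hm := opt R hRdense (WF ⟨v - p, hvp⟩) ψ (c + (⟪v, l⟫).im)
    have hi : ⟪WF ⟨v - p, hvp⟩, ψ⟫ = ⟪v, l⟫ - ⟪p, l⟫ := by
      rw [← hl, ← inner_sub_left]
      exact sa_inner hFsa ⟨v - p, hvp⟩ ⟨ψ, hψ⟩
    have hfl : ∀ f : V.domain, ⟪(f : H), l⟫ = ⟪R f, ψ⟫ := by
      intro f
      rw [← hl]
      exact hRd ⟨ψ, hψ⟩ f
    simp_rw [hw, hfl]
    rw [hm, hi, Complex.sub_im]
    constructor <;> intro h <;> linarith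
  refine ⟨hbij, ?_, ?_⟩
  · intro h hh
    obtain ⟨p, hp, hhp⟩ := hdec h hh
    refine ⟨p, ⟨(hker p).2 hp, hhp⟩, ?_⟩
    rintro q ⟨hq, hhq⟩
    have hq' := (hker q).1 hq
    have hd : p - q ∈ WF.domain := by
      have := WF.domain.sub_mem hhq hhp
      simpa using this
    have h0 : WF ⟨p - q, hd⟩ = 0 := by
      refine hRdense.eq_zero_of_inner_left ℂ ?_
      intro f
      rw [← hRa, inner_sub_left, hp, hq', sub_zero]
    have h1 : (⟨p - q, hd⟩ : WF.domain) = 0 := hbij.1 (by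
      change WF ⟨p - q, hd⟩ = WF 0
      rw [h0, LinearPMap.map_zero])
    have h2 : p - q = 0 := congrArg Subtype.val h1
    exact (sub_eq_zero.1 h2).symm
  · rw [hred]
    constructor
    · intro h
      refine ⟨fun v => ?_, ?_⟩
      · obtain ⟨ψ, hψ⟩ := hbij.2 (L v)
        have hψ' : WF ψ = L v := hψ
        refine (hKiff v).1 (bdd_of_form R ((innerₛₗ ℂ (v : H)).comp V.toFun) ψ
          ((⟪(v : H), At.adjoint ⟨(v : H), h𝓥 v.2⟩⟫).im + (⟪(v : H), L v⟫).im) fun f => ?_)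
        have := h v (h𝓥 v.2) f
        have e : ⟪(f : H), L v⟫ = ⟪R f, (ψ : H)⟫ := by rw [← hψ', hRd]
        rw [e] at this
        exact this
      · intro v hv hvK p hp hp0 hvp ψ hψ hl
        exact (hcrit (L v) v p ψ _ hvK ((hker p).1 ⟨hp, hp0⟩) hvp hψ hl).1 (h v hv)
    · rintro ⟨hK, h⟩ v hv
      obtain ⟨p, hp, hvp⟩ := hdec v (hK v)
      obtain ⟨hp1, hp0⟩ := (hker p).2 hp
      obtain ⟨ψ, hψ⟩ := hbij.2 (L v)
      exact (hcrit (L v) v p ψ _ (hK v) hp hvp ψ.2 hψ).2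
        (h v hv (hK v) p hp1 hp0 hvp ψ ψ.2 hψ)
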